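/- Suppose the collection 𝒫_A^⊆ of potential-outcome distributions obeys distributional consistency and 𝒫_A obeys the SWIG ordered local Markov property for the DAG 𝒢 under ≺ (modularity). Then for every i ∈ V, every a ∈ 𝔛_A and every v ∈ 𝔛_V such that p(X_{pre(i)}(a) = v_{pre(i)}) > 0 and p(X_{pa(i)∖A} = v_{pa(i)∖A}, X_{pa(i)∩A} = a_{pa(i)∩A}) > 0: p(X_i(a) = v_i | X_{pre(i)}(a) = v_{pre(i)}) = p(X_i = v_i | X_{pa(i)∖A} = v_{pa(i)∖A}, X_{pa(i)∩A} = a_{pa(i)∩A}). Consequently, whenever all the observed conditioning events on the right have positive probability, p(V(a) = v) = Π_{i∈V} p(X_i = v_i | X_{pa(i)∖A} = v_{pa(i)∖A}, X_{pa(i)∩A} = a_{pa(i)∩A}) (the g-formula), so that p(V(a)) is identified from the observed distribution p(V). -/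

import Mathlib

open Finset

namespace CausalPaper

variable {V : Type*} [Fintype V] [LinearOrder V]
variable {𝔛 : V → Type*} [∀ i, Fintype (𝔛 i)]

/-- Probability of the event `E` under the distribution `q` on joint assignments. -/
noncomputable def pr (q : (∀ i, 𝔛 i) → ℝ) (E : (∀ i, 𝔛 i) → Prop) : ℝ :=
  ∑ v : (∀ i, 𝔛 i), Set.indicator (setOf E) q v

/-- Conditional probability of `E` given `F` under `q`. -/
noncomputable def cpr (q : (∀ i, 𝔛 i) → ℝ) (E F : (∀ i, 𝔛 i) → Prop) : ℝ :=
  pr q (fun v => E v ∧ F v) / pr q F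

/-- `q` is a probability distribution on joint assignments. -/
def IsProb (q : (∀ i, 𝔛 i) → ℝ) : Prop :=
  (∀ v, 0 ≤ q v) ∧ (∑ v : (∀ i, 𝔛 i), q v) = 1

/-- `v` agrees with `s` on the coordinates in `S`. -/
def agree (S : Finset V) (s v : ∀ i, 𝔛 i) : Prop :=
  ∀ i ∈ S, v i = s i

/-- The intervention/regime that sets the variables in `B` according to `b`
(and is idle elsewhere). -/
def setOn (B : Finset V) (b : ∀ i, 𝔛 i) : ∀ i, Option (𝔛 i) :=
  fun i => if i ∈ B then some (b i) else none

/-- The support of the partial intervention/regime `f` is contained in `A`. -/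
def suppIn (f : ∀ i, Option (𝔛 i)) (A : Finset V) : Prop :=
  ∀ i, f i ≠ none → i ∈ A

/-- Distributional consistency. -/
def DistConsistent (A : Finset V) (P : (∀ i, Option (𝔛 i)) → (∀ i, 𝔛 i) → ℝ) : Prop :=
  ∀ i ∈ A, ∀ C : Finset V, C ⊆ A \ {i} →
    ∀ (y : ∀ j, 𝔛 j) (b : 𝔛 i) (c : ∀ j, 𝔛 j),
      pr (P (Function.update (setOn C c) i (some b)))
          (fun v => agree (univ \ {i}) y v ∧ v i = b)
        = pr (P (setOn C c)) (fun v => agree (univ \ {i}) y v ∧ v i = b)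

/-- The predecessors of `i` under the total order on `V`. -/
def pre (i : V) : Finset V := univ.filter (fun j => j < i)

/-- The (SWIG / augmented-DAG) ordered local Markov property: under the regime
intervening on all of `A`, the conditional distribution of `X_i` given its
predecessors is a function only of `a` on `pa i ∩ A` and of `w` on `pa i \ A`. -/
def SWIGLocalMarkov (A : Finset V) (pa : V → Finset V)
    (P : (∀ i, Option (𝔛 i)) → (∀ i, 𝔛 i) → ℝ) : Prop :=
  ∀ (i : V) (a a' w w' : ∀ j, 𝔛 j) (x : 𝔛 i),
    0 < pr (P (setOn A a)) (agree (pre i) w) →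
    0 < pr (P (setOn A a')) (agree (pre i) w') →
    (∀ j ∈ pa i ∩ A, a j = a' j) →
    (∀ j ∈ pa i \ A, w j = w' j) →
    cpr (P (setOn A a)) (fun v => v i = x) (agree (pre i) w)
      = cpr (P (setOn A a')) (fun v => v i = x) (agree (pre i) w')

/-- The ordinary ordered local Markov property for a single distribution `q`:
the conditional distribution of `X_i` given its predecessors is a function only
of the values of the parents. -/
def OrderedLocalMarkov (pa : V → Finset V) (q : (∀ i, 𝔛 i) → ℝ) : Prop :=
  ∀ (i : V) (w w' : ∀ j, 𝔛 j) (x : 𝔛 i),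
    0 < pr q (agree (pre i) w) →
    0 < pr q (agree (pre i) w') →
    (∀ j ∈ pa i, w j = w' j) →
    cpr q (fun v => v i = x) (agree (pre i) w)
      = cpr q (fun v => v i = x) (agree (pre i) w')

open Classical in
theorem pr_eq_sum_ite (q : (∀ i, 𝔛 i) → ℝ) (E : (∀ i, 𝔛 i) → Prop) :
    pr q E = ∑ v : (∀ i, 𝔛 i), if E v then q v else 0 :=
  Finset.sum_congr rfl fun v _ => Set.indicator_apply _ q v

theorem pr_congr (q : (∀ i, 𝔛 i) → ℝ) {E F : (∀ i, 𝔛 i) → Prop} (h : ∀ v, E v ↔ F v) :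
    pr q E = pr q F := by
  rw [show E = F from funext fun v => propext (h v)]

theorem pr_nonneg {q : (∀ i, 𝔛 i) → ℝ} (hq : ∀ v, 0 ≤ q v) (E : (∀ i, 𝔛 i) → Prop) :
    0 ≤ pr q E :=
  Finset.sum_nonneg fun v _ => Set.indicator_nonneg (fun u _ => hq u) v

theorem pr_mono {q : (∀ i, 𝔛 i) → ℝ} (hq : ∀ v, 0 ≤ q v) {E F : (∀ i, 𝔛 i) → Prop}
    (h : ∀ v, E v → F v) : pr q E ≤ pr q F :=
  Finset.sum_le_sum fun v _ =>
    Set.indicator_le_indicator_of_subset (fun u hu => h u hu) (fun u => hq u) v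

theorem pr_and_eq_cpr_mul {q : (∀ i, 𝔛 i) → ℝ} (hq : ∀ v, 0 ≤ q v)
    (E F : (∀ i, 𝔛 i) → Prop) : pr q (fun v => E v ∧ F v) = cpr q E F * pr q F := by
  by_cases h : pr q F = 0
  · rw [h, mul_zero]
    exact le_antisymm (h ▸ pr_mono hq fun v hv => hv.2) (pr_nonneg hq _)
  · rw [cpr, div_mul_cancel₀ _ h]

theorem pr_eq_apply (q : (∀ i, 𝔛 i) → ℝ) {E : (∀ i, 𝔛 i) → Prop} {w : ∀ i, 𝔛 i}
    (h : ∀ v, E v ↔ v = w) : pr q E = q w := by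
  rw [pr, Finset.sum_eq_single w]
  · exact Set.indicator_of_mem ((h w).2 rfl) q
  · intro v _ hv
    exact Set.indicator_of_notMem (fun hE => hv ((h v).1 hE)) q
  · simp

theorem pr_agree_empty {q : (∀ i, 𝔛 i) → ℝ} (hq : IsProb q) (w : ∀ i, 𝔛 i) :
    pr q (agree ∅ w) = 1 := by
  rw [← hq.2, pr_eq_sum_ite]
  exact Finset.sum_congr rfl fun v _ => if_pos (by simp [agree])

theorem pr_eq_sum_coord (q : (∀ i, 𝔛 i) → ℝ) (E : (∀ i, 𝔛 i) → Prop) (i : V) :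
    pr q E = ∑ x : 𝔛 i, pr q (fun v => v i = x ∧ E v) := by
  simp only [pr_eq_sum_ite]
  rw [Finset.sum_comm]
  refine Finset.sum_congr rfl fun v _ => ?_
  rw [Finset.sum_eq_single (v i)]
  · by_cases h : E v
    · rw [if_pos h, if_pos ⟨rfl, h⟩]
    · rw [if_neg h, if_neg fun h' => h h'.2]
  · intro x _ hx
    exact if_neg fun h => hx h.1.symm
  · simp

/-- If the identity `pr (E ∧ ·) = c * pr (·)` holds on every cell of the partition by the
coordinates in `S` contained in `F`, then it holds for `F`. -/
theorem pr_and_eq_mul_of_cells (q : (∀ i, 𝔛 i) → ℝ) (S : Finset V)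
    (E F : (∀ i, 𝔛 i) → Prop) (c : ℝ)
    (hF : ∀ w u, agree S w u → (F u ↔ F w))
    (h : ∀ w, F w → pr q (fun v => E v ∧ agree S w v) = c * pr q (agree S w)) :
    pr q (fun v => E v ∧ F v) = c * pr q F := by
  classical
  simp only [pr_eq_sum_ite] at h ⊢
  rw [← Finset.sum_fiberwise univ (fun u : (∀ i, 𝔛 i) => S.restrict u),
    ← Finset.sum_fiberwise univ (fun u : (∀ i, 𝔛 i) => S.restrict u)
      (fun v => if F v then q v else 0), Finset.mul_sum]
  refine Finset.sum_congr rfl fun t _ => ?_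
  by_cases ht : ∃ w, S.restrict w = t ∧ F w
  · obtain ⟨w, rfl, hw⟩ := ht
    have hr : ∀ u, S.restrict u = S.restrict w ↔ agree S w u := fun u =>
      ⟨fun hu i hi => congrFun hu ⟨i, hi⟩, fun hu => funext fun i => hu i.1 i.2⟩
    have hw' := h w hw
    rw [Finset.sum_filter, Finset.sum_filter]
    convert hw' using 2
    · rename_i u _
      by_cases hu : agree S w u
      · simp [hr, hu, hF w u hu, hw]
      · simp [hr, hu]
    · refine Finset.sum_congr rfl fun u _ => ?_
      by_cases hu : agree S w u
      · simp [hr, hu, hF w u hu, hw]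
      · simp [hr, hu]
  · have hz : ∀ u, S.restrict u = t → ¬ F u := fun u hu hFu => ht ⟨u, hu, hFu⟩
    rw [Finset.sum_eq_zero, Finset.sum_eq_zero, mul_zero]
    · intro u hu
      exact if_neg (hz u (Finset.mem_filter.1 hu).2)
    · intro u hu
      exact if_neg fun hEF => hz u (Finset.mem_filter.1 hu).2 hEF.2

theorem agree_insert_iff {S : Finset V} {i : V} (w v : ∀ j, 𝔛 j) :
    agree (insert i S) w v ↔ v i = w i ∧ agree S w v := by
  simp [agree]

theorem agree_congr {S : Finset V} {w w' : ∀ j, 𝔛 j} (h : ∀ j ∈ S, w j = w' j)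
    (v : ∀ j, 𝔛 j) : agree S w v ↔ agree S w' v :=
  forall₂_congr fun j hj => by rw [h j hj]

theorem mem_pre {i j : V} : j ∈ pre i ↔ j < i := by simp [pre]

theorem eq_pre_of_insert_lower {s : Finset V} {i : V} (hlt : ∀ j ∈ s, j < i)
    (hs : ∀ k ∈ insert i s, pre k ⊆ insert i s) : s = pre i := by
  ext j
  refine ⟨fun hj => mem_pre.2 (hlt j hj), fun hj => ?_⟩
  exact (Finset.mem_insert.1 (hs i (Finset.mem_insert_self i s) hj)).resolve_left
    (mem_pre.1 hj).ne

theorem pre_lower (i : V) : ∀ k ∈ pre i, pre k ⊆ pre i := fun _ hk _ hj =>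
  mem_pre.2 ((mem_pre.1 hj).trans (mem_pre.1 hk))

theorem insert_pre_lower (i : V) : ∀ k ∈ insert i (pre i), pre k ⊆ insert i (pre i) := by
  intro k hk j hj
  rcases Finset.mem_insert.1 hk with rfl | hk
  · exact Finset.mem_insert_of_mem hj
  · exact Finset.mem_insert_of_mem (pre_lower i k hk hj)

/-- Induction on initial segments of the order, adding one element at a time. -/
theorem lower_induction {p : Finset V → Prop} (h_empty : p ∅)
    (h_insert : ∀ i, p (pre i) → p (insert i (pre i))) (S : Finset V)
    (hS : ∀ k ∈ S, pre k ⊆ S) : p S := by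
  induction S using Finset.induction_on_max with
  | empty => exact h_empty
  | insert i s hlt ih =>
    obtain rfl := eq_pre_of_insert_lower hlt hS
    exact h_insert i (ih (pre_lower i))

theorem suppIn_setOn {A B : Finset V} (hB : B ⊆ A) (b : ∀ i, 𝔛 i) : suppIn (setOn B b) A := by
  intro i hi
  by_contra h
  exact hi (if_neg fun hiB => h (hB hiB))

section Regime

variable {A : Finset V} {pa : V → Finset V} {P : (∀ i, Option (𝔛 i)) → (∀ i, 𝔛 i) → ℝ}

theorem DistConsistent.apply_setOn (hDC : DistConsistent A P) (w : ∀ i, 𝔛 i)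
    (B : Finset V) (hB : B ⊆ A) : P (setOn B w) w = P (fun _ => none) w := by
  induction B using Finset.induction_on with
  | empty =>
    rw [show setOn ∅ w = fun _ => none from
      funext fun j => if_neg (Finset.notMem_empty j)]
  | insert i C hi ih =>
    have hC : C ⊆ A := (Finset.subset_insert i C).trans hB
    rw [← ih hC]
    have hE : ∀ v : (∀ j, 𝔛 j), (agree (univ \ {i}) w v ∧ v i = w i) ↔ v = w := by
      refine fun v => ⟨fun h => funext fun j => ?_, fun h => by simp [h, agree]⟩
      by_cases hj : j = i
      · subst hj
        exact h.2
      · exact h.1 j (by simpa using hj)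
    have h := hDC i (hB (Finset.mem_insert_self i C)) C
      (fun j hj => Finset.mem_sdiff.2
        ⟨hC hj, by simpa using fun h : j = i => hi (h ▸ hj)⟩) w (w i) w
    rw [pr_eq_apply _ hE, pr_eq_apply _ hE] at h
    rw [← h]
    congr 1
    funext j
    by_cases hj : j = i
    · subst hj
      simp [setOn]
    · simp [setOn, hj]

theorem SWIGLocalMarkov.pr_coord_and_pre_congr (hM : SWIGLocalMarkov A pa P)
    (hP : ∀ a v, 0 ≤ P (setOn A a) v) (i : V) {a a' w : ∀ j, 𝔛 j}
    (ha : ∀ j ∈ pa i ∩ A, a j = a' j)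
    (hpre : pr (P (setOn A a)) (agree (pre i) w) = pr (P (setOn A a')) (agree (pre i) w))
    (x : 𝔛 i) :
    pr (P (setOn A a)) (fun v => v i = x ∧ agree (pre i) w v)
      = pr (P (setOn A a')) (fun v => v i = x ∧ agree (pre i) w v) := by
  rw [pr_and_eq_cpr_mul (hP a) (fun v => v i = x), pr_and_eq_cpr_mul (hP a') (fun v => v i = x)]
  rcases (pr_nonneg (hP a) (agree (pre i) w)).eq_or_lt with h0 | hpos
  · rw [← hpre, ← h0, mul_zero, mul_zero]
  · rw [hM i a a' w w x hpos (hpre ▸ hpos) ha fun _ _ => rfl, hpre]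

/-- The marginal on an initial segment depends only on the interventions that precede some
element of the segment. -/
theorem SWIGLocalMarkov.pr_agree_lower_congr (hM : SWIGLocalMarkov A pa P)
    (hpa : ∀ i, pa i ⊆ pre i) (hP : ∀ a, IsProb (P (setOn A a)))
    (w : ∀ j, 𝔛 j) (S : Finset V) (hS : ∀ k ∈ S, pre k ⊆ S) {a a' : ∀ j, 𝔛 j}
    (ha : ∀ i ∈ S, ∀ j ∈ pre i, a j = a' j) :
    pr (P (setOn A a)) (agree S w) = pr (P (setOn A a')) (agree S w) := by
  refine lower_induction (p := fun S => (∀ i ∈ S, ∀ j ∈ pre i, a j = a' j) →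
    pr (P (setOn A a)) (agree S w) = pr (P (setOn A a')) (agree S w)) ?_ ?_ S hS ha
  · intro _
    rw [pr_agree_empty (hP a), pr_agree_empty (hP a')]
  · intro i ih h
    rw [pr_congr _ (agree_insert_iff w), pr_congr _ (agree_insert_iff w)]
    exact hM.pr_coord_and_pre_congr (fun a => (hP a).1) i
      (fun j hj => h i (Finset.mem_insert_self _ _) j (hpa i (Finset.mem_inter.1 hj).1))
      (ih fun k hk => h k (Finset.mem_insert_of_mem hk)) (w i)

theorem pr_coord_and_agree_eq (q : (∀ i, 𝔛 i) → ℝ) {S : Finset V} {i : V} (hi : i ∉ S)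
    (w : ∀ j, 𝔛 j) (x : 𝔛 i) :
    pr q (fun v => v i = x ∧ agree S w v)
      = pr q (agree (insert i S) (Function.update w i x)) := by
  refine pr_congr _ fun v => ?_
  rw [agree_insert_iff, Function.update_self]
  refine and_congr_right fun _ => agree_congr (fun j hj => ?_) v
  rw [Function.update_of_ne fun h : j = i => hi (h ▸ hj)]

theorem pr_setOn_update_eq (hpa : ∀ i, pa i ⊆ pre i) (hP : ∀ a, IsProb (P (setOn A a)))
    (hM : SWIGLocalMarkov A pa P) (i : V) (w : ∀ j, 𝔛 j) (x : 𝔛 i) :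
    pr (P (setOn A (Function.update w i x))) (fun v => v i = x ∧ agree (pre i) w v)
      = pr (P (setOn A w)) (fun v => v i = x ∧ agree (pre i) w v) := by
  have hne : ∀ j ∈ pre i, Function.update w i x j = w j := fun j hj =>
    Function.update_of_ne (mem_pre.1 hj).ne x w
  exact hM.pr_coord_and_pre_congr (fun a => (hP a).1) i
    (fun j hj => hne j (hpa i (Finset.mem_inter.1 hj).1))
    (hM.pr_agree_lower_congr hpa hP w _ (pre_lower i)
      fun k hk j hj => hne j (pre_lower i k hk hj)) x

/-- On an initial segment, the observed probability of a configuration is its probability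
under the intervention setting `A` to that same configuration. -/
theorem pr_none_agree_lower (hpa : ∀ i, pa i ⊆ pre i) (hP : ∀ a, IsProb (P (setOn A a)))
    (hDC : DistConsistent A P) (hM : SWIGLocalMarkov A pa P) (S : Finset V)
    (hS : ∀ k ∈ S, pre k ⊆ S) (w : ∀ j, 𝔛 j) :
    pr (P fun _ => none) (agree S w) = pr (P (setOn A w)) (agree S w) := by
  induction hn : Sᶜ.card using Nat.strong_induction_on generalizing S w with
  | _ n ih =>
    by_cases hne : Sᶜ.Nonempty
    · set i := Sᶜ.min' hne
      have hi : i ∉ S := Finset.mem_compl.1 (Finset.min'_mem _ hne)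
      have hSi : S = pre i := by
        ext j
        rw [mem_pre]
        refine ⟨fun hj => ?_, fun hj => ?_⟩
        · by_contra hji
          rcases (not_lt.1 hji).eq_or_lt with h | h
          · exact hi (h ▸ hj)
          · exact hi (hS j hj (mem_pre.2 h))
        · by_contra hjS
          exact absurd hj (not_lt.2 (Finset.min'_le _ j (Finset.mem_compl.2 hjS)))
      clear_value i
      subst hSi
      rw [pr_eq_sum_coord _ _ i, pr_eq_sum_coord (P (setOn A w)) _ i]
      refine Finset.sum_congr rfl fun x _ => ?_
      rw [← pr_setOn_update_eq hpa hP hM, pr_coord_and_agree_eq _ hi, pr_coord_and_agree_eq _ hi]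
      refine ih _ ?_ _ (insert_pre_lower i) _ rfl
      rw [← hn]
      refine Finset.card_lt_card (Finset.compl_ssubset_compl.2 (Finset.ssubset_insert hi))
    · have hSu : S = univ := by simpa using hne
      have hE : ∀ v : (∀ j, 𝔛 j), agree S w v ↔ v = w := fun v => by
        simp [hSu, agree, funext_iff]
      rw [pr_eq_apply _ hE, pr_eq_apply _ hE, hDC.apply_setOn w A subset_rfl]

theorem pr_none_coord_and_pre (hpa : ∀ i, pa i ⊆ pre i) (hP : ∀ a, IsProb (P (setOn A a)))
    (hDC : DistConsistent A P) (hM : SWIGLocalMarkov A pa P) (i : V) (w : ∀ j, 𝔛 j) (x : 𝔛 i) :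
    pr (P fun _ => none) (fun v => v i = x ∧ agree (pre i) w v)
      = pr (P (setOn A w)) (fun v => v i = x ∧ agree (pre i) w v) := by
  have hi : i ∉ pre i := fun h => lt_irrefl i (mem_pre.1 h)
  rw [← pr_setOn_update_eq hpa hP hM, pr_coord_and_agree_eq _ hi, pr_coord_and_agree_eq _ hi]
  exact pr_none_agree_lower hpa hP hDC hM _ (insert_pre_lower i) _

theorem cpr_setOn_eq_cpr_none (hpa : ∀ i, pa i ⊆ pre i) (hP : ∀ a, IsProb (P (setOn A a)))
    (hDC : DistConsistent A P) (hM : SWIGLocalMarkov A pa P) (i : V) (a v : ∀ j, 𝔛 j) (x : 𝔛 i)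
    (hpos : 0 < pr (P (setOn A a)) (agree (pre i) v))
    (hobs : 0 < pr (P fun _ => none)
      (fun u => agree (pa i \ A) v u ∧ agree (pa i ∩ A) a u)) :
    cpr (P (setOn A a)) (fun u => u i = x) (agree (pre i) v)
      = cpr (P fun _ => none) (fun u => u i = x)
          (fun u => agree (pa i \ A) v u ∧ agree (pa i ∩ A) a u) := by
  refine eq_div_of_mul_eq hobs.ne' (Eq.symm ?_)
  refine pr_and_eq_mul_of_cells _ (pre i) (fun u => u i = x) _ _ ?_ ?_
  · intro w u hu
    have h : ∀ j ∈ pa i, u j = w j := fun j hj => hu j (hpa i hj)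
    refine and_congr ?_ ?_
    · exact forall₂_congr fun j hj => by rw [h j (Finset.mem_sdiff.1 hj).1]
    · exact forall₂_congr fun j hj => by rw [h j (Finset.mem_inter.1 hj).1]
  · rintro w ⟨hwv, hwa⟩
    rw [pr_none_coord_and_pre hpa hP hDC hM,
      pr_none_agree_lower hpa hP hDC hM _ (pre_lower i) w,
      pr_and_eq_cpr_mul (hP w).1 (fun u => u i = x)]
    rcases (pr_nonneg (hP w).1 (agree (pre i) w)).eq_or_lt with h0 | hw
    · rw [← h0, mul_zero, mul_zero]
    · rw [hM i w a w v x hw hpos hwa hwv]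

end Regime

/-- Theorem 2 (modularity and the g-formula): each interventional conditional
equals the corresponding observed conditional given the parents, and consequently
`p(V(a))` is given by the g-formula whenever the observed conditioning events
have positive probability. -/
theorem stmt7_swig_identification
    (A : Finset V) (hA : A ⊆ univ)
    (pa : V → Finset V) (hpa : ∀ i, pa i ⊆ pre i)
    (P : (∀ i, Option (𝔛 i)) → (∀ i, 𝔛 i) → ℝ)
    (hP : ∀ f, suppIn f A → IsProb (P f))
    (hDC : DistConsistent A P)
    (hM : SWIGLocalMarkov A pa P) :
    (∀ (i : V) (a v : ∀ j, 𝔛 j),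
      0 < pr (P (setOn A a)) (agree (pre i) v) →
      0 < pr (P (fun _ => none))
            (fun u => agree (pa i \ A) v u ∧ agree (pa i ∩ A) a u) →
      cpr (P (setOn A a)) (fun u => u i = v i) (agree (pre i) v)
        = cpr (P (fun _ => none)) (fun u => u i = v i)
            (fun u => agree (pa i \ A) v u ∧ agree (pa i ∩ A) a u)) ∧
    (∀ (a v : ∀ j, 𝔛 j),
      (∀ i : V, 0 < pr (P (fun _ => none))
          (fun u => agree (pa i \ A) v u ∧ agree (pa i ∩ A) a u)) →
      P (setOn A a) v
        = ∏ i : V, cpr (P (fun _ => none)) (fun u => u i = v i)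
            (fun u => agree (pa i \ A) v u ∧ agree (pa i ∩ A) a u)) := by
  have hP' : ∀ a, IsProb (P (setOn A a)) := fun a => hP _ (suppIn_setOn subset_rfl a)
  refine ⟨fun i a v => cpr_setOn_eq_cpr_none hpa hP' hDC hM i a v (v i), fun a v hobs => ?_⟩
  rw [← pr_eq_apply (P (setOn A a)) (E := agree univ v) fun u => by simp [agree, funext_iff]]
  refine lower_induction (p := fun S => pr (P (setOn A a)) (agree S v)
    = ∏ i ∈ S, cpr (P (fun _ => none)) (fun u => u i = v i)
        (fun u => agree (pa i \ A) v u ∧ agree (pa i ∩ A) a u)) ?_ ?_ univ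
    fun k _ => Finset.subset_univ _
  · rw [pr_agree_empty (hP' a), Finset.prod_empty]
  · intro i ih
    rw [Finset.prod_insert fun h => lt_irrefl i (mem_pre.1 h), ← ih,
      pr_congr _ (agree_insert_iff v), pr_and_eq_cpr_mul (hP' a).1 (fun u => u i = v i)]
    rcases (pr_nonneg (hP' a).1 (agree (pre i) v)).eq_or_lt with h0 | hpos
    · rw [← h0, mul_zero, mul_zero]
    · rw [cpr_setOn_eq_cpr_none hpa hP' hDC hM i a v (v i) hpos (hobs i)]


end CausalPaper
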